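/- Fix ν ∈ (0,1). For every integer j ≥ 4, the scheme coefficients satisfy d_{j−1}^j > 0, d_0^j > 0 and d_1^j > 0. -/

import Mathlib

open Real Finset

noncomputable section

/-- α₀ = (ν+2)/(2^ν·Γ(3−ν)). -/
def alpha0 (ν : ℝ) : ℝ := (ν + 2) / ((2 : ℝ) ^ ν * Real.Gamma (3 - ν))

/-- θ = 2ν/(2+ν). -/
def theta (ν : ℝ) : ℝ := 2 * ν / (2 + ν)

/-- The coefficients D̄_k^(m). -/
def Dbar (ν : ℝ) (m k : ℕ) : ℝ :=
  if k = 0 then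
    (1 / Real.Gamma (3 - ν)) *
      (-((2 - ν) / 2) * ((2 * m : ℝ) ^ (1 - ν) + 3 * ((2 * m : ℝ) + 2) ^ (1 - ν))
        - (2 * m : ℝ) ^ (2 - ν) + ((2 * m : ℝ) + 2) ^ (2 - ν))
  else if k % 2 = 0 then
    (1 / Real.Gamma (3 - ν)) *
      (-((2 - ν) / 2) * (((2 * m : ℝ) - 2 * (k / 2 : ℕ)) ^ (1 - ν)
          + 6 * ((2 * m : ℝ) - 2 * (k / 2 : ℕ) + 2) ^ (1 - ν)
          + ((2 * m : ℝ) - 2 * (k / 2 : ℕ) + 4) ^ (1 - ν))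
        - ((2 * m : ℝ) - 2 * (k / 2 : ℕ)) ^ (2 - ν)
        + ((2 * m : ℝ) - 2 * (k / 2 : ℕ) + 4) ^ (2 - ν))
  else
    (2 / Real.Gamma (3 - ν)) *
      ((2 - ν) * (((2 * m : ℝ) - 2 * (k / 2 : ℕ)) ^ (1 - ν)
          + ((2 * m : ℝ) - 2 * (k / 2 : ℕ) + 2) ^ (1 - ν))
        + ((2 * m : ℝ) - 2 * (k / 2 : ℕ)) ^ (2 - ν)
        - ((2 * m : ℝ) - 2 * (k / 2 : ℕ) + 2) ^ (2 - ν))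

/-- The coefficients D_k^(m); for k ≥ 3 one has D_k^(m) = D̄_{k+1}^(m). -/
def Dco (ν : ℝ) (m k : ℕ) : ℝ :=
  if k = 0 then
    (1 / Real.Gamma (3 - ν)) *
      (((2 - ν) / 2) * ((2 * m : ℝ) ^ (1 - ν) - 3 * ((2 * m : ℝ) + 1) ^ (1 - ν))
        - (2 * m : ℝ) ^ (2 - ν) + ((2 * m : ℝ) + 1) ^ (2 - ν))
  else if k = 1 then
    (1 / Real.Gamma (3 - ν)) *
      (-((2 - ν) / 2) * (((2 * m : ℝ) - 2) ^ (1 - ν) + 3 * (2 * m : ℝ) ^ (1 - ν)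
          - 4 * ((2 * m : ℝ) + 1) ^ (1 - ν))
        - ((2 * m : ℝ) - 2) ^ (2 - ν) + 3 * (2 * m : ℝ) ^ (2 - ν)
        - 2 * ((2 * m : ℝ) + 1) ^ (2 - ν))
  else if k = 2 then
    (1 / Real.Gamma (3 - ν)) *
      (((2 - ν) / 2) * (4 * ((2 * m : ℝ) - 2) ^ (1 - ν) + 3 * (2 * m : ℝ) ^ (1 - ν)
          - ((2 * m : ℝ) + 1) ^ (1 - ν))
        + 2 * ((2 * m : ℝ) - 2) ^ (2 - ν) - 3 * (2 * m : ℝ) ^ (2 - ν)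
        + ((2 * m : ℝ) + 1) ^ (2 - ν))
  else Dbar ν m (k + 1)

/-- The scheme coefficients d_k^j. -/
def dco (ν : ℝ) (j k : ℕ) : ℝ :=
  if j % 2 = 1 then -Dco ν (j / 2) k / alpha0 ν
  else -Dbar ν (j / 2 - 1) k / alpha0 ν

/-- The transformed coefficients d̄_k^j. -/
def dbarco (ν : ℝ) (j k : ℕ) : ℝ :=
  if k = j then -1
  else if j = 3 then
    if k = 2 then dco ν 3 2 - theta ν
    else if k = 1 then theta ν * (dco ν 3 2 - theta ν) + dco ν 3 1
    else theta ν * (theta ν * (dco ν 3 2 - theta ν) + dco ν 3 1) + dco ν 3 0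
  else
    theta ν ^ (j - k) + ∑ k' ∈ Finset.Icc k (j - 2), dco ν j k' * theta ν ^ (k' - k)

/-- The coefficients B̄_i^n: B̄_0^n = Δx^{−ν}α₀ and
    B̄_{n−k}^n = B̄_{n−k−1}^n − Δx^{−ν}·α₀·d̄_k^n for k = n−1,…,1. -/
def Bbar (ν Δx : ℝ) (n : ℕ) : ℕ → ℝ
  | 0 => Δx ^ (-ν) * alpha0 ν
  | i + 1 => Bbar ν Δx n i - Δx ^ (-ν) * alpha0 ν * dbarco ν n (n - (i + 1))

/-- The complementary discrete kernels P_j^n. -/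
def Pker (ν Δx : ℝ) (n : ℕ) : ℕ → ℝ
  | 0 => 1 / Bbar ν Δx n 0
  | j + 1 =>
    if n ≤ j + 3 then 0
    else (1 / Bbar ν Δx (n - (j + 1)) 0) *
      ∑ k ∈ (Finset.range (j + 1)).attach,
        (Bbar ν Δx (n - k.1) (j - k.1) - Bbar ν Δx (n - k.1) (j + 1 - k.1)) * Pker ν Δx n k.1
  decreasing_by
    have := Finset.mem_range.mp k.2; omega

/-- D̂_0, D̂_1, D̂_2, D̃_0, D̃_1, D̃_2 : first/second-step coefficients. -/
def Dhat0 (ν : ℝ) : ℝ := (3 * ν - 4) / (2 * Real.Gamma (3 - ν))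
def Dhat1 (ν : ℝ) : ℝ := 2 * (1 - ν) / Real.Gamma (3 - ν)
def Dhat2 (ν : ℝ) : ℝ := ν / (2 * Real.Gamma (3 - ν))
def Dtil0 (ν : ℝ) : ℝ := (3 * ν - 2) / ((2 : ℝ) ^ ν * Real.Gamma (3 - ν))
def Dtil1 (ν : ℝ) : ℝ := -(4 * ν) / ((2 : ℝ) ^ ν * Real.Gamma (3 - ν))
def Dtil2 (ν : ℝ) : ℝ := (ν + 2) / ((2 : ℝ) ^ ν * Real.Gamma (3 - ν))

/-- The Caputo fractional derivative of order ν. -/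
def caputo (ν : ℝ) (y : ℝ → ℝ) (x : ℝ) : ℝ :=
  (1 / Real.Gamma (1 - ν)) * ∫ s in (0:ℝ)..x, (x - s) ^ (-ν) * deriv y s

/-- The discrete Caputo derivative of a function y at the grid point x_j = jΔx. -/
def discCaputo (ν Δx : ℝ) (y : ℝ → ℝ) (j : ℕ) : ℝ :=
  if j = 1 then
    Δx ^ (-ν) * (Dhat0 ν * y 0 + Dhat1 ν * y Δx + Dhat2 ν * y (2 * Δx))
  else if j = 2 then
    Δx ^ (-ν) * (Dtil0 ν * y 0 + Dtil1 ν * y Δx + Dtil2 ν * y (2 * Δx))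
  else if j % 2 = 1 then
    Δx ^ (-ν) * ((∑ k ∈ Finset.range j, Dco ν (j / 2) k * y ((k : ℝ) * Δx))
      + alpha0 ν * y ((j : ℝ) * Δx))
  else
    Δx ^ (-ν) * ((∑ k ∈ Finset.range j, Dbar ν (j / 2 - 1) k * y ((k : ℝ) * Δx))
      + alpha0 ν * y ((j : ℝ) * Δx))

/-- Truncation error r_j(Δx). -/
def trunc (ν Δx : ℝ) (y : ℝ → ℝ) (j : ℕ) : ℝ :=
  caputo ν y ((j : ℝ) * Δx) - discCaputo ν Δx y j

/-- The Mittag–Leffler function E_ν(z) = Σ_{k≥0} z^k/Γ(1+kν). -/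
def mlE (ν z : ℝ) : ℝ := ∑' k : ℕ, z ^ k / Real.Gamma (1 + (k : ℝ) * ν)

end

/-- If a combination of the functions `s ↦ (xᵢ + s)⁻¹` with weights of total mass zero is
nonpositive, then the same combination of the powers `xᵢ ^ p` is nonnegative, for `0 < p < 1`. -/
lemma sum_mul_rpow_nonneg_of_sum_mul_inv_nonpos {ι : Type*} (S : Finset ι) (w x : ι → ℝ) {p : ℝ}
    (hp : p ∈ Set.Ioo (0 : ℝ) 1) (hx : ∀ i ∈ S, 0 ≤ x i) (hw : ∑ i ∈ S, w i = 0)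
    (h : ∀ s : ℝ, 0 < s → ∑ i ∈ S, w i * (s + x i)⁻¹ ≤ 0) :
    0 ≤ ∑ i ∈ S, w i * x i ^ p := by
  have hC : 0 ≤ (∫ t in Set.Ioi 0, rpowIntegrand₀₁ p t 1)⁻¹ :=
    (inv_pos.mpr (integral_rpowIntegrand₀₁_one_pos hp)).le
  have hsum : ∑ i ∈ S, w i * x i ^ p = (∫ t in Set.Ioi 0, rpowIntegrand₀₁ p t 1)⁻¹ *
      ∫ t in Set.Ioi 0, ∑ i ∈ S, w i * rpowIntegrand₀₁ p t (x i) := by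
    rw [MeasureTheory.integral_finsetSum _
      (fun i hi => (integrableOn_rpowIntegrand₀₁_Ioi hp (hx i hi)).const_mul _), Finset.mul_sum]
    refine Finset.sum_congr rfl fun i hi => ?_
    rw [MeasureTheory.integral_const_mul, rpow_eq_const_mul_integral hp (hx i hi)]
    ring
  rw [hsum]
  refine mul_nonneg hC (MeasureTheory.setIntegral_nonneg measurableSet_Ioi fun t ht => ?_)
  have ht' : 0 < t := ht
  have : ∑ i ∈ S, w i * rpowIntegrand₀₁ p t (x i)
      = t ^ p * (t⁻¹ * ∑ i ∈ S, w i - ∑ i ∈ S, w i * (t + x i)⁻¹) := by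
    simp only [rpowIntegrand₀₁, Finset.mul_sum, mul_sub, ← Finset.sum_sub_distrib]
    exact Finset.sum_congr rfl fun i _ => by ring
  rw [this, hw]
  exact mul_nonneg (rpow_nonneg ht'.le _) (by linarith [h t ht'])

/-- Strict midpoint inequality for the integral of `t ^ p` over `[c - h, c + h]`. -/
lemma rpow_add_one_sub_lt_midpoint {p c h : ℝ} (hp : p ∈ Set.Ioo (0 : ℝ) 1) (hh : 0 < h)
    (hc : h < c) :
    (c + h) ^ (p + 1) - (c - h) ^ (p + 1) < 2 * h * (p + 1) * c ^ p := by
  have hd : ∀ t ∈ Set.Icc (0 : ℝ) h, HasDerivAt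
      (fun t : ℝ => (c + t) ^ (p + 1) - (c - t) ^ (p + 1) - 2 * t * (p + 1) * c ^ p)
      ((p + 1) * ((c + t) ^ p + (c - t) ^ p - 2 * c ^ p)) t := by
    intro t ht
    have h1 := ((hasDerivAt_id t).const_add c).rpow_const (p := p + 1)
      (Or.inl (by simp only [id]; linarith [ht.1]))
    have h2 := ((hasDerivAt_id t).const_sub c).rpow_const (p := p + 1)
      (Or.inl (by simp only [id]; linarith [ht.2]))
    have h3 := (((hasDerivAt_id t).const_mul 2).mul_const (p + 1)).mul_const (c ^ p)
    refine ((h1.sub h2).sub h3).congr_deriv ?_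
    simp only [id, add_sub_cancel_right]
    ring
  have hanti : StrictAntiOn
      (fun t : ℝ => (c + t) ^ (p + 1) - (c - t) ^ (p + 1) - 2 * t * (p + 1) * c ^ p)
      (Set.Icc 0 h) := by
    refine strictAntiOn_of_deriv_neg (convex_Icc 0 h)
      (fun t ht => (hd t ht).continuousAt.continuousWithinAt) fun t ht => ?_
    rw [interior_Icc] at ht
    rw [(hd t (Set.Ioo_subset_Icc_self ht)).deriv]
    have hconc := (strictConcaveOn_rpow hp.1 hp.2).2
      (show c + t ∈ Set.Ici (0 : ℝ) by simp only [Set.mem_Ici]; linarith [ht.1])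
      (show c - t ∈ Set.Ici (0 : ℝ) by simp only [Set.mem_Ici]; linarith [ht.2])
      (by linarith [ht.1] : c + t ≠ c - t) (by norm_num : (0 : ℝ) < 1 / 2)
      (by norm_num : (0 : ℝ) < 1 / 2) (by norm_num)
    simp only [smul_eq_mul] at hconc
    rw [show 1 / 2 * (c + t) + 1 / 2 * (c - t) = c by ring] at hconc
    nlinarith [hp.1]
  have := hanti (Set.left_mem_Icc.mpr hh.le) (Set.right_mem_Icc.mpr hh.le) hh
  simp only [add_zero, sub_zero, mul_zero, zero_mul, sub_self] at this
  linarith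

/-- The graph of `t ^ p` lies strictly below its tangent line at `y`. -/
lemma rpow_lt_tangent {p x y : ℝ} (hp : p ∈ Set.Ioo (0 : ℝ) 1) (hx : 0 ≤ x) (hy : 0 < y)
    (hxy : x ≠ y) : x ^ p < y ^ p + p * y ^ (p - 1) * (x - y) := by
  have h := rpow_one_add_lt_one_add_mul_self (s := x / y - 1)
    (by linarith [div_nonneg hx hy.le])
    (fun h0 => hxy (by field_simp at h0; linarith)) hp.1 hp.2
  rw [add_sub_cancel, div_rpow hx hy.le, div_lt_iff₀ (rpow_pos_of_pos hy p)] at h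
  rw [rpow_sub_one hy.ne']
  calc x ^ p < (1 + p * (x / y - 1)) * y ^ p := h
    _ = _ := by field_simp

/-- Strict trapezoid inequality for the integral of `t ^ p` over `[x, y]`. -/
lemma trapezoid_lt_rpow_add_one_sub {p x y : ℝ} (hp : p ∈ Set.Ioo (0 : ℝ) 1) (hx : 0 < x)
    (hxy : x < y) :
    (p + 1) / 2 * (x ^ p + y ^ p) * (y - x) < y ^ (p + 1) - x ^ (p + 1) := by
  have hd : ∀ t ∈ Set.Icc x y, HasDerivAt
      (fun t : ℝ => t ^ (p + 1) - x ^ (p + 1) - (p + 1) / 2 * (x ^ p + t ^ p) * (t - x))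
      ((p + 1) / 2 * (t ^ p + p * t ^ (p - 1) * (x - t) - x ^ p)) t := by
    intro t ht
    have ht0 : t ≠ 0 := (hx.trans_le ht.1).ne'
    have h1 := (hasDerivAt_rpow_const (x := t) (p := p + 1) (Or.inl ht0)).sub_const (x ^ (p + 1))
    have h2 := (((hasDerivAt_rpow_const (x := t) (p := p) (Or.inl ht0)).const_add
      (x ^ p)).const_mul ((p + 1) / 2)).mul ((hasDerivAt_id t).sub_const x)
    refine (h1.sub h2).congr_deriv ?_
    simp only [id, add_sub_cancel_right]
    ring
  have hmono : StrictMonoOn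
      (fun t : ℝ => t ^ (p + 1) - x ^ (p + 1) - (p + 1) / 2 * (x ^ p + t ^ p) * (t - x))
      (Set.Icc x y) := by
    refine strictMonoOn_of_deriv_pos (convex_Icc x y)
      (fun t ht => (hd t ht).continuousAt.continuousWithinAt) fun t ht => ?_
    rw [interior_Icc] at ht
    rw [(hd t (Set.Ioo_subset_Icc_self ht)).deriv]
    have := rpow_lt_tangent hp hx.le (hx.trans ht.1) ht.1.ne
    exact mul_pos (by linarith [hp.1]) (by linarith)
  have := hmono (Set.left_mem_Icc.mpr hxy.le) (Set.right_mem_Icc.mpr hxy.le) hxy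
  simp only [sub_self, mul_zero] at this
  linarith

lemma four_mul_rpow_le {p x : ℝ} (hp : p ∈ Set.Ioo (0 : ℝ) 1) (hx : 1 ≤ x) :
    4 * (x + 1) ^ p ≤ x ^ p + 3 * (x + 2) ^ p := by
  have h := sum_mul_rpow_nonneg_of_sum_mul_inv_nonpos Finset.univ ![1, -4, 3] ![x, x + 1, x + 2] hp
    (by intro i _; fin_cases i <;> simp <;> linarith)
    (by simp [Fin.sum_univ_succ]; norm_num)
    (by
      intro s hs
      simp only [Fin.sum_univ_three, Matrix.cons_val]
      have h1 : 0 < s + x := by linarith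
      have h2 : 0 < s + (x + 1) := by linarith
      have h3 : 0 < s + (x + 2) := by linarith
      have : 1 * (s + x)⁻¹ + -4 * (s + (x + 1))⁻¹ + 3 * (s + (x + 2))⁻¹
          = -(2 * (s + (x - 1))) / ((s + x) * (s + (x + 1)) * (s + (x + 2))) := by
        field_simp
        ring
      rw [this]
      exact div_nonpos_of_nonpos_of_nonneg (by linarith) (by positivity))
  simp only [Fin.sum_univ_three, Matrix.cons_val] at h
  linarith

lemma two_mul_rpow_add_le {p x : ℝ} (hp : p ∈ Set.Ioo (0 : ℝ) 1) (hx : 4 ≤ x) :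
    2 * (x - 3 / 2) ^ p + 2 * (x - 1 / 2) ^ p + 2 * (x + 1) ^ p ≤ (x - 2) ^ p + 5 * x ^ p := by
  have h := sum_mul_rpow_nonneg_of_sum_mul_inv_nonpos Finset.univ ![1, -2, -2, 5, -2]
    ![x - 2, x - 3 / 2, x - 1 / 2, x, x + 1] hp
    (by intro i _; fin_cases i <;> simp <;> linarith)
    (by simp [Fin.sum_univ_succ]; norm_num)
    (by
      intro s hs
      simp only [Fin.sum_univ_five, Matrix.cons_val]
      obtain ⟨z, hz, hz0⟩ : ∃ z, x = z + 4 - s ∧ 0 < z := ⟨x + s - 4, by ring, by linarith⟩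
      subst hz
      rw [show s + (z + 4 - s - 2) = z + 2 by ring,
        show s + (z + 4 - s - 3 / 2) = z + 5 / 2 by ring,
        show s + (z + 4 - s - 1 / 2) = z + 7 / 2 by ring,
        show s + (z + 4 - s) = z + 4 by ring,
        show s + (z + 4 - s + 1) = z + 5 by ring]
      have : 2 * (z + 5 / 2)⁻¹ + 2 * (z + 7 / 2)⁻¹ + 2 * (z + 5)⁻¹
          - ((z + 2)⁻¹ + 5 * (z + 4)⁻¹) ≥ 0 := by
        rw [ge_iff_le, sub_nonneg]
        have e1 : (z + 2)⁻¹ + 5 * (z + 4)⁻¹ = (6 * z + 14) / ((z + 2) * (z + 4)) := by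
          field_simp
          ring
        have e2 : 2 * (z + 5 / 2)⁻¹ + 2 * (z + 7 / 2)⁻¹ + 2 * (z + 5)⁻¹
            = (2 * (z + 7 / 2) * (z + 5) + 2 * (z + 5 / 2) * (z + 5)
              + 2 * (z + 5 / 2) * (z + 7 / 2)) / ((z + 5 / 2) * (z + 7 / 2) * (z + 5)) := by
          field_simp
        rw [e1, e2, div_le_div_iff₀ (by positivity) (by positivity)]
        nlinarith [pow_pos hz0 2, pow_pos hz0 3]
      linarith)
  simp only [Fin.sum_univ_five, Matrix.cons_val] at h
  linarith

lemma Dbar_zero_neg {ν : ℝ} (hν : ν ∈ Set.Ioo (0 : ℝ) 1) {m : ℕ} (hm : 1 ≤ m) :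
    Dbar ν m 0 < 0 := by
  have hG : 0 < Real.Gamma (3 - ν) := Gamma_pos_of_pos (by linarith [hν.2])
  have hp : 1 - ν ∈ Set.Ioo (0 : ℝ) 1 := ⟨by linarith [hν.2], by linarith [hν.1]⟩
  have hm' : (1 : ℝ) ≤ m := by exact_mod_cast hm
  have h1 := rpow_add_one_sub_lt_midpoint (c := 2 * (m : ℝ) + 1) hp one_pos (by linarith)
  rw [show 2 * (m : ℝ) + 1 + 1 = 2 * m + 2 by ring, add_sub_cancel_right,
    show 1 - ν + 1 = 2 - ν by ring] at h1
  have h2 := four_mul_rpow_le hp (by linarith : (1 : ℝ) ≤ 2 * m)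
  rw [Dbar, if_pos rfl]
  refine mul_neg_of_pos_of_neg (by positivity) ?_
  nlinarith [hν.2]

lemma Dbar_one_neg {ν : ℝ} (hν : ν ∈ Set.Ioo (0 : ℝ) 1) {m : ℕ} (hm : 1 ≤ m) :
    Dbar ν m 1 < 0 := by
  have hG : 0 < Real.Gamma (3 - ν) := Gamma_pos_of_pos (by linarith [hν.2])
  have hp : 1 - ν ∈ Set.Ioo (0 : ℝ) 1 := ⟨by linarith [hν.2], by linarith [hν.1]⟩
  have hm' : (1 : ℝ) ≤ m := by exact_mod_cast hm
  have h := trapezoid_lt_rpow_add_one_sub (x := 2 * (m : ℝ)) (y := 2 * m + 2) hp (by linarith)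
    (by linarith)
  rw [show 1 - ν + 1 = 2 - ν by ring] at h
  rw [Dbar, if_neg one_ne_zero, if_neg (by norm_num)]
  refine mul_neg_of_pos_of_neg (by positivity) ?_
  norm_num
  linarith

lemma Dbar_two_mul_add_one_self_neg {ν : ℝ} (hν : ν ∈ Set.Ioo (0 : ℝ) 1) (m : ℕ) :
    Dbar ν m (2 * m + 1) < 0 := by
  have hG : 0 < Real.Gamma (3 - ν) := Gamma_pos_of_pos (by linarith [hν.2])
  rw [Dbar, if_neg (by omega), if_neg (by omega), show (2 * m + 1) / 2 = m by omega, sub_self,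
    zero_add, zero_rpow (by linarith [hν.2]), zero_rpow (by linarith [hν.2]),
    show 2 - ν = 1 - ν + 1 by ring, rpow_add_one two_ne_zero]
  refine mul_neg_of_pos_of_neg (by positivity) ?_
  nlinarith [rpow_pos_of_pos two_pos (1 - ν), hν.1]

lemma Dco_zero_neg {ν : ℝ} (hν : ν ∈ Set.Ioo (0 : ℝ) 1) {m : ℕ} (hm : 1 ≤ m) :
    Dco ν m 0 < 0 := by
  have hG : 0 < Real.Gamma (3 - ν) := Gamma_pos_of_pos (by linarith [hν.2])
  have hp : 1 - ν ∈ Set.Ioo (0 : ℝ) 1 := ⟨by linarith [hν.2], by linarith [hν.1]⟩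
  have hm' : (1 : ℝ) ≤ m := by exact_mod_cast hm
  have h1 := rpow_add_one_sub_lt_midpoint (c := 2 * (m : ℝ) + 1 / 2) (h := 1 / 2) hp
    (by norm_num) (by linarith)
  rw [show 2 * (m : ℝ) + 1 / 2 + 1 / 2 = 2 * m + 1 by ring, add_sub_cancel_right,
    show 1 - ν + 1 = 2 - ν by ring] at h1
  have h2 : (2 * (m : ℝ) + 1 / 2) ^ (1 - ν) < (2 * (m : ℝ) + 1) ^ (1 - ν) :=
    rpow_lt_rpow (by linarith) (by linarith) hp.1
  have h3 : (2 * (m : ℝ)) ^ (1 - ν) < (2 * (m : ℝ) + 1) ^ (1 - ν) :=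
    rpow_lt_rpow (by linarith) (by linarith) hp.1
  rw [Dco, if_pos rfl]
  refine mul_neg_of_pos_of_neg (by positivity) ?_
  nlinarith [hν.2]

lemma Dco_one_neg {ν : ℝ} (hν : ν ∈ Set.Ioo (0 : ℝ) 1) {m : ℕ} (hm : 2 ≤ m) :
    Dco ν m 1 < 0 := by
  have hG : 0 < Real.Gamma (3 - ν) := Gamma_pos_of_pos (by linarith [hν.2])
  have hp : 1 - ν ∈ Set.Ioo (0 : ℝ) 1 := ⟨by linarith [hν.2], by linarith [hν.1]⟩
  have hx : (4 : ℝ) ≤ 2 * m := by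
    have : (2 : ℝ) ≤ m := by exact_mod_cast hm
    linarith
  rw [Dco, if_neg one_ne_zero, if_pos rfl]
  refine mul_neg_of_pos_of_neg (by positivity) ?_
  generalize 2 * (m : ℝ) = x at hx ⊢
  have h1 := rpow_add_one_sub_lt_midpoint (c := x - 3 / 2) (h := 1 / 2) hp
    (by norm_num) (by linarith)
  have h2 := rpow_add_one_sub_lt_midpoint (c := x - 1 / 2) (h := 1 / 2) hp
    (by norm_num) (by linarith)
  have h3 := trapezoid_lt_rpow_add_one_sub (x := x) (y := x + 1) hp (by linarith) (by linarith)
  rw [show x - 3 / 2 + 1 / 2 = x - 1 by ring, show x - 3 / 2 - 1 / 2 = x - 2 by ring,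
    show 1 - ν + 1 = 2 - ν by ring] at h1
  rw [sub_add_cancel, show x - 1 / 2 - 1 / 2 = x - 1 by ring,
    show 1 - ν + 1 = 2 - ν by ring] at h2
  rw [show 1 - ν + 1 = 2 - ν by ring] at h3
  have h4 := mul_le_mul_of_nonneg_left (two_mul_rpow_add_le hp hx)
    (by linarith [hν.2] : 0 ≤ (2 - ν) / 2)
  linarith

lemma alpha0_pos {ν : ℝ} (hν : ν ∈ Set.Ioo (0 : ℝ) 1) : 0 < alpha0 ν := by
  have hG : 0 < Real.Gamma (3 - ν) := Gamma_pos_of_pos (by linarith [hν.2])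
  have := hν.1
  exact div_pos (by linarith) (by positivity)

theorem stmt2 (ν : ℝ) (hν : ν ∈ Set.Ioo (0:ℝ) 1) (j : ℕ) (hj : 4 ≤ j) :
    0 < dco ν j (j - 1) ∧ 0 < dco ν j 0 ∧ 0 < dco ν j 1 := by
  have hα := alpha0_pos hν
  rcases Nat.even_or_odd' j with ⟨n, rfl | rfl⟩
  · obtain ⟨m, rfl⟩ : ∃ m, n = m + 1 := ⟨n - 1, by omega⟩
    have h2 : 2 * (m + 1) / 2 - 1 = m := by omega
    have h3 : 2 * (m + 1) - 1 = 2 * m + 1 := by omega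
    simp only [dco, if_neg (by omega : ¬ 2 * (m + 1) % 2 = 1), h2, h3]
    exact ⟨div_pos (neg_pos.mpr (Dbar_two_mul_add_one_self_neg hν m)) hα,
      div_pos (neg_pos.mpr (Dbar_zero_neg hν (by omega))) hα,
      div_pos (neg_pos.mpr (Dbar_one_neg hν (by omega))) hα⟩
  · have h2 : (2 * n + 1) / 2 = n := by omega
    have hlast : Dco ν n (2 * n) = Dbar ν n (2 * n + 1) := by
      rw [Dco, if_neg (by omega), if_neg (by omega), if_neg (by omega)]
    simp only [dco, if_pos (by omega : (2 * n + 1) % 2 = 1), h2, Nat.add_sub_cancel, hlast]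
    exact ⟨div_pos (neg_pos.mpr (Dbar_two_mul_add_one_self_neg hν n)) hα,
      div_pos (neg_pos.mpr (Dco_zero_neg hν (by omega))) hα,
      div_pos (neg_pos.mpr (Dco_one_neg hν (by omega))) hα⟩
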